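/- Let Y : Ω → ℝ be square-integrable with respect to the product probability measure μ and suppose Var_μ(Y) > 0. Then the Sobol' sensitivity indices S_I = σ²_I(Y)/σ²(Y) satisfy Σ_{∅ ≠ I ⊆ N} S_I = 1. -/

import Mathlib

open MeasureTheory

/-- The marginal `A_J Y`: integrate out the coordinates not in `J`,
i.e. `(A_J Y)(x) = ∫ Y(z) dμ_{N∖J}(z)` with `z_i = x_i` for `i ∈ J`. -/
noncomputable def margA {M : ℕ} {Ω : Fin M → Type*} [∀ i, MeasurableSpace (Ω i)]
    (μ : ∀ i, Measure (Ω i)) (J : Finset (Fin M)) (Y : (∀ i, Ω i) → ℝ) :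
    (∀ i, Ω i) → ℝ :=
  fun x => ∫ z, Y (fun i => if i ∈ J then x i else z i) ∂(Measure.pi μ)

/-- The ANOVA projection `P_I Y`, defined recursively by
`P_I Y = A_I Y - ∑_{J ⊊ I} P_J Y` (so that `P_∅ Y = 𝔼_μ[Y]`). -/
noncomputable def anovaP {M : ℕ} {Ω : Fin M → Type*} [∀ i, MeasurableSpace (Ω i)]
    (μ : ∀ i, Measure (Ω i)) (Y : (∀ i, Ω i) → ℝ) (I : Finset (Fin M)) :
    (∀ i, Ω i) → ℝ :=
  margA μ I Y - ∑ J ∈ I.ssubsets.attach, anovaP μ Y J.1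
termination_by I.card
decreasing_by exact Finset.card_lt_card (Finset.mem_ssubsets.mp J.2)
open ProbabilityTheory


section Abstract

open scoped InnerProductSpace

variable {ι : Type*} [DecidableEq ι] {E : Type*} [NormedAddCommGroup E] [InnerProductSpace ℝ E]

lemma abs_P_eq (A P : Finset ι → E) (hP : ∀ I, ∑ J ∈ I.powerset, P J = A I) (I : Finset ι) :
    P I = A I - ∑ J ∈ I.ssubsets, P J := by
  rw [← hP I, Finset.ssubsets, ← Finset.add_sum_erase _ _ (Finset.mem_powerset_self I)]
  abel

lemma abs_orth1 (A P : Finset ι → E) (V : Finset ι → ℝ)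
    (hP : ∀ I, ∑ J ∈ I.powerset, P J = A I)
    (hA : ∀ J K, ⟪A J, A K⟫_ℝ = V (J ∩ K)) (K : Finset ι) (I : Finset ι) (h : ¬ I ⊆ K) :
    ⟪P I, A K⟫_ℝ = 0 := by
  induction I using Finset.strongInduction with
  | H I ih =>
    have h1 : ∑ J ∈ I.ssubsets, ⟪P J, A K⟫_ℝ = ∑ J ∈ (I ∩ K).powerset, ⟪P J, A K⟫_ℝ := by
      symm
      apply Finset.sum_subset
      · intro J hJ
        rw [Finset.mem_powerset] at hJ
        rw [Finset.mem_ssubsets]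
        refine ⟨hJ.trans Finset.inter_subset_left, fun hh => h ?_⟩
        exact (hh.trans hJ).trans Finset.inter_subset_right
      · intro J hJ hJ2
        rw [Finset.mem_ssubsets] at hJ
        apply ih J hJ
        intro hh
        exact hJ2 (Finset.mem_powerset.2 (Finset.subset_inter hJ.1 hh))
    rw [abs_P_eq A P hP I, inner_sub_left, sum_inner, h1, ← sum_inner, hP, hA, hA]
    simp

lemma abs_orth2 (A P : Finset ι → E) (V : Finset ι → ℝ)
    (hP : ∀ I, ∑ J ∈ I.powerset, P J = A I)
    (hA : ∀ J K, ⟪A J, A K⟫_ℝ = V (J ∩ K)) (I : Finset ι) (K : Finset ι) (h : ¬ I ⊆ K) :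
    ⟪P I, P K⟫_ℝ = 0 := by
  induction K using Finset.strongInduction with
  | H K ih =>
    rw [abs_P_eq A P hP K, inner_sub_right, abs_orth1 A P V hP hA K I h, inner_sum,
      Finset.sum_eq_zero, sub_zero]
    intro J hJ
    rw [Finset.mem_ssubsets] at hJ
    exact ih J hJ (fun hh => h (hh.trans hJ.1))

lemma abs_sum (A P : Finset ι → E) (V : Finset ι → ℝ)
    (hP : ∀ I, ∑ J ∈ I.powerset, P J = A I)
    (hA : ∀ J K, ⟪A J, A K⟫_ℝ = V (J ∩ K)) (K : Finset ι) :
    ∑ I ∈ K.powerset, ⟪P I, P I⟫_ℝ = ⟪A K, A K⟫_ℝ := by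
  rw [← hP K, sum_inner]
  refine Finset.sum_congr rfl fun I hI => ?_
  rw [inner_sum, Finset.sum_eq_single I]
  · intro J _ hJ
    by_cases h : I ⊆ J
    · rw [real_inner_comm]
      exact abs_orth2 A P V hP hA J I (fun h' => hJ (h'.antisymm h))
    · exact abs_orth2 A P V hP hA I J h
  · exact fun h => absurd hI h

end Abstract

section Concrete

variable {M : ℕ} {Ω : Fin M → Type*} [∀ i, MeasurableSpace (Ω i)]

/-- Take coordinates in `J` from `x` and the others from `z`. -/
def cmb (J : Finset (Fin M)) (x z : ∀ i, Ω i) : ∀ i, Ω i :=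
  fun i => if i ∈ J then x i else z i

lemma measurable_cmb (J : Finset (Fin M)) :
    Measurable (fun p : (∀ i, Ω i) × (∀ i, Ω i) => cmb J p.1 p.2) := by
  refine measurable_pi_lambda _ fun i => ?_
  by_cases h : i ∈ J
  · simp only [cmb, h, if_true]; fun_prop
  · simp only [cmb, h, if_false]; fun_prop

lemma mp_swap (μ : ∀ i, Measure (Ω i)) [∀ i, IsProbabilityMeasure (μ i)] (J : Finset (Fin M)) :
    MeasurePreserving (fun p : (∀ i, Ω i) × (∀ i, Ω i) => (cmb J p.1 p.2, cmb J p.2 p.1))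
      ((Measure.pi μ).prod (Measure.pi μ)) ((Measure.pi μ).prod (Measure.pi μ)) := by
  have hm : Measurable
      (fun p : (∀ i, Ω i) × (∀ i, Ω i) => (cmb J p.1 p.2, cmb J p.2 p.1)) :=
    (measurable_cmb J).prodMk ((measurable_cmb J).comp measurable_swap)
  refine ⟨hm, ?_⟩
  symm
  refine Measure.prod_eq_generateFrom generateFrom_pi generateFrom_pi isPiSystem_pi isPiSystem_pi
    (Measure.FiniteSpanningSetsIn.pi fun i => (μ i).toFiniteSpanningSetsIn)
    (Measure.FiniteSpanningSetsIn.pi fun i => (μ i).toFiniteSpanningSetsIn) ?_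
  rintro _ ⟨s, hs, rfl⟩ _ ⟨t, ht, rfl⟩
  have hs' : ∀ i, MeasurableSet (s i) := fun i => hs i trivial
  have ht' : ∀ i, MeasurableSet (t i) := fun i => ht i trivial
  rw [Measure.map_apply hm ((MeasurableSet.univ_pi hs').prod (MeasurableSet.univ_pi ht'))]
  have : (fun p : (∀ i, Ω i) × (∀ i, Ω i) => (cmb J p.1 p.2, cmb J p.2 p.1)) ⁻¹'
      (Set.univ.pi s ×ˢ Set.univ.pi t) =
      (Set.univ.pi fun i => if i ∈ J then s i else t i) ×ˢ
      (Set.univ.pi fun i => if i ∈ J then t i else s i) := by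
    ext ⟨x, z⟩
    simp only [Set.mem_preimage, Set.mem_prod, Set.mem_univ_pi, cmb, ← forall_and]
    refine forall_congr' fun i => ?_
    by_cases h : i ∈ J <;> simp [h, and_comm]
  rw [this, Measure.prod_prod, Measure.pi_pi, Measure.pi_pi, Measure.pi_pi, Measure.pi_pi,
    ← Finset.prod_mul_distrib, ← Finset.prod_mul_distrib]
  refine Finset.prod_congr rfl fun i _ => ?_
  by_cases h : i ∈ J <;> simp [h, mul_comm]

variable (μ : ∀ i, Measure (Ω i)) [∀ i, IsProbabilityMeasure (μ i)]

lemma mp_cmb (J : Finset (Fin M)) :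
    MeasurePreserving (fun p : (∀ i, Ω i) × (∀ i, Ω i) => cmb J p.1 p.2)
      ((Measure.pi μ).prod (Measure.pi μ)) (Measure.pi μ) :=
  measurePreserving_fst.comp (mp_swap μ J)

lemma memLp_margA (J : Finset (Fin M)) {Y : (∀ i, Ω i) → ℝ} (hY : MemLp Y 2 (Measure.pi μ)) :
    MemLp (margA μ J Y) 2 (Measure.pi μ) := by
  have h1 : MemLp (fun p : (∀ i, Ω i) × (∀ i, Ω i) => Y (cmb J p.1 p.2)) 2
      ((Measure.pi μ).prod (Measure.pi μ)) := hY.comp_measurePreserving (mp_cmb μ J)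
  have hm : AEStronglyMeasurable (margA μ J Y) (Measure.pi μ) :=
    h1.aestronglyMeasurable.integral_prod_right'
  rw [memLp_two_iff_integrable_sq hm]
  have h2 := h1.integrable_sq
  refine h2.integral_prod_left.mono' (hm.pow 2) ?_
  filter_upwards [h2.prod_right_ae, h1.aestronglyMeasurable.prodMk_left] with x hx hx2
  have hx3 : MemLp (fun z => Y (cmb J x z)) 2 (Measure.pi μ) :=
    (memLp_two_iff_integrable_sq hx2).2 hx
  have := variance_nonneg (fun z => Y (cmb J x z)) (Measure.pi μ)
  rw [variance_eq_sub hx3] at this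
  rw [Real.norm_of_nonneg (sq_nonneg _)]
  exact sub_nonneg.1 this

lemma margA_margA (J K : Finset (Fin M)) {Y : (∀ i, Ω i) → ℝ} (hY : MemLp Y 2 (Measure.pi μ)) :
    margA μ J (margA μ K Y) =ᵐ[Measure.pi μ] margA μ (J ∩ K) Y := by
  have h1 : MemLp (fun p : (∀ i, Ω i) × (∀ i, Ω i) => Y (cmb (J ∩ K) p.1 p.2)) 2
      ((Measure.pi μ).prod (Measure.pi μ)) := hY.comp_measurePreserving (mp_cmb μ (J ∩ K))
  filter_upwards [(h1.integrable one_le_two).prod_right_ae] with x hx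
  have hx : Integrable (fun z => Y (cmb (J ∩ K) x z)) (Measure.pi μ) := hx
  have h2 := (mp_cmb μ K).integrable_comp_of_integrable hx
  have h3 : ∫ p, Y (cmb (J ∩ K) x (cmb K p.1 p.2)) ∂((Measure.pi μ).prod (Measure.pi μ))
      = ∫ z, Y (cmb (J ∩ K) x z) ∂(Measure.pi μ) := by
    have ha : AEStronglyMeasurable (fun z => Y (cmb (J ∩ K) x z))
      (Measure.map (fun p : (∀ i, Ω i) × (∀ i, Ω i) => cmb K p.1 p.2)
        ((Measure.pi μ).prod (Measure.pi μ))) := by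
      rw [(mp_cmb μ K).map_eq]; exact hx.aestronglyMeasurable
    rw [← integral_map (mp_cmb μ K).measurable.aemeasurable ha, (mp_cmb μ K).map_eq]
  simp only [Function.comp_def] at h2
  rw [integral_prod _ h2] at h3
  refine Eq.trans ?_ h3
  change ∫ z, ∫ w, Y (cmb K (cmb J x z) w) ∂(Measure.pi μ) ∂(Measure.pi μ) = _
  have : ∀ z w, cmb K (cmb J x z) w = cmb (J ∩ K) x (cmb K z w) := by
    intro z w
    funext i
    by_cases hJ : i ∈ J <;> by_cases hK : i ∈ K <;> simp [cmb, hJ, hK]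
  simp only [this]

lemma margA_adj (J : Finset (Fin M)) {f g : (∀ i, Ω i) → ℝ} (hf : MemLp f 2 (Measure.pi μ))
    (hg : MemLp g 2 (Measure.pi μ)) :
    ∫ x, margA μ J f x * g x ∂(Measure.pi μ) = ∫ x, f x * margA μ J g x ∂(Measure.pi μ) := by
  have hF : Integrable (fun p : (∀ i, Ω i) × (∀ i, Ω i) => f p.1 * g (cmb J p.1 p.2))
      ((Measure.pi μ).prod (Measure.pi μ)) :=
    (hf.comp_measurePreserving measurePreserving_fst).integrable_mul
      (hg.comp_measurePreserving (mp_cmb μ J))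
  have hS := mp_swap μ J
  have hG := hS.integrable_comp_of_integrable hF
  have ha := hF.aestronglyMeasurable
  have h3 := integral_map (φ := (fun p : (∀ i, Ω i) × (∀ i, Ω i) =>
    (cmb J p.1 p.2, cmb J p.2 p.1))) (μ := (Measure.pi μ).prod (Measure.pi μ))
    (f := (fun p : (∀ i, Ω i) × (∀ i, Ω i) => f p.1 * g (cmb J p.1 p.2)))
    hS.measurable.aemeasurable (by rw [hS.map_eq]; exact ha)
  rw [hS.map_eq, integral_prod _ hF] at h3
  have hc : ∀ x z : (∀ i, Ω i), cmb J (cmb J x z) (cmb J z x) = x := by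
    intro x z
    funext i
    by_cases hJ : i ∈ J <;> simp [cmb, hJ]
  simp only [Function.comp_def, hc] at h3 hG
  rw [integral_prod _ hG] at h3
  simp only [integral_const_mul, integral_mul_const] at h3
  exact h3.symm

lemma anovaP_eq (Y : (∀ i, Ω i) → ℝ) (I : Finset (Fin M)) :
    anovaP μ Y I = margA μ I Y - ∑ J ∈ I.ssubsets, anovaP μ Y J := by
  rw [anovaP, Finset.sum_attach I.ssubsets (fun J => anovaP μ Y J)]

lemma memLp_anovaP {Y : (∀ i, Ω i) → ℝ} (hY : MemLp Y 2 (Measure.pi μ)) (I : Finset (Fin M)) :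
    MemLp (anovaP μ Y I) 2 (Measure.pi μ) := by
  induction I using Finset.strongInduction with
  | H I ih =>
    rw [anovaP_eq]
    exact (memLp_margA μ I hY).sub
      (memLp_finsetSum' _ fun J hJ => ih J (Finset.mem_ssubsets.1 hJ))

lemma sum_anovaP (Y : (∀ i, Ω i) → ℝ) (I : Finset (Fin M)) :
    ∑ J ∈ I.powerset, anovaP μ Y J = margA μ I Y := by
  rw [← Finset.add_sum_erase _ _ (Finset.mem_powerset_self I), anovaP_eq, Finset.ssubsets]
  abel

lemma inner_toLp_eq {α : Type*} [MeasurableSpace α] {ν : Measure α} {f g : α → ℝ}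
    (hf : MemLp f 2 ν) (hg : MemLp g 2 ν) :
    inner ℝ (hf.toLp f) (hg.toLp g) = ∫ x, f x * g x ∂ν := by
  rw [L2.inner_def]
  refine integral_congr_ae ?_
  filter_upwards [hf.coeFn_toLp, hg.coeFn_toLp] with x h1 h2
  rw [h1, h2]
  simp [mul_comm]

lemma toLp_finset_sum {α κ : Type*} [MeasurableSpace α] {ν : Measure α} (f : κ → α → ℝ)
    (hf : ∀ k, MemLp (f k) 2 ν) (s : Finset κ) :
    ∑ k ∈ s, (hf k).toLp (f k) = (memLp_finsetSum' s fun k _ => hf k).toLp (∑ k ∈ s, f k) := by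
  classical
  induction s using Finset.induction_on with
  | empty => simp only [Finset.sum_empty]; exact (MemLp.toLp_zero _).symm
  | insert a s ha ih =>
    simp only [Finset.sum_insert ha, ih]
    exact (MemLp.toLp_add _ _).symm

lemma sum_sq_anovaP {Y : (∀ i, Ω i) → ℝ} (hY : MemLp Y 2 (Measure.pi μ)) :
    ∑ I ∈ (Finset.univ : Finset (Fin M)).powerset, ∫ x, (anovaP μ Y I x) ^ 2 ∂(Measure.pi μ)
      = ∫ x, (Y x) ^ 2 ∂(Measure.pi μ) := by
  have key := abs_sum (fun I => (memLp_margA μ I hY).toLp (margA μ I Y))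
    (fun I => (memLp_anovaP μ hY I).toLp (anovaP μ Y I))
    (fun S => ∫ x, Y x * margA μ S Y x ∂(Measure.pi μ))
    (by
      intro I
      rw [toLp_finset_sum (fun I => anovaP μ Y I) (memLp_anovaP μ hY)]
      simp only [sum_anovaP])
    (by
      intro J K
      rw [inner_toLp_eq, margA_adj μ J hY (memLp_margA μ K hY)]
      refine integral_congr_ae ?_
      filter_upwards [margA_margA μ J K hY] with x hx
      rw [hx])
    Finset.univ
  simp only [inner_toLp_eq, ← pow_two] at key
  rw [key]
  simp [margA]

end Concrete

/-- **Sobol' indices sum to one.** If `Y` is square-integrable w.r.t. the product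
probability measure and `Var(Y) > 0`, then the Sobol' indices
`S_I = σ²_I(Y)/σ²(Y)` satisfy `∑_{∅ ≠ I ⊆ N} S_I = 1`. -/
theorem sum_sobol_indices_eq_one
    {M : ℕ} (hM : 1 ≤ M) {Ω : Fin M → Type*} [∀ i, MeasurableSpace (Ω i)]
    (μ : ∀ i, Measure (Ω i)) [∀ i, IsProbabilityMeasure (μ i)]
    (Y : (∀ i, Ω i) → ℝ) (hY : MemLp Y 2 (Measure.pi μ))
    (hvar : 0 < variance Y (Measure.pi μ)) :
    ∑ I ∈ (Finset.univ : Finset (Fin M)).powerset.erase ∅,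
        (∫ x, (anovaP μ Y I x) ^ 2 ∂(Measure.pi μ)) / variance Y (Measure.pi μ)
      = 1 := by
  have h0 : anovaP μ Y ∅ = fun _ => ∫ x, Y x ∂(Measure.pi μ) := by
    rw [anovaP_eq]
    have : (∅ : Finset (Fin M)).ssubsets = ∅ := by
      simp [Finset.ssubsets]
    rw [this]
    funext x
    simp [margA]
  have h1 := sum_sq_anovaP μ hY
  rw [← Finset.add_sum_erase _ _ (Finset.empty_mem_powerset _), h0] at h1
  rw [← Finset.sum_div, div_eq_one_iff_eq hvar.ne', variance_eq_sub hY]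
  simp only [integral_const, probReal_univ, one_smul] at h1
  simp only [Pi.pow_apply]
  linarith
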